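/- arXiv:1003.2165 — 2 statements merged into one kernel-verified Lean document; each statement's English description precedes it below -/
import Mathlib

section
/- Let k ≥ 3 be an integer, B > 1, α > 0, and ξ ∈ [k−1, k]. Then λ̃_norm^k(ξ) ≥ ((1 − B^{−α})^k/(α·ln B))·(k − ξ)^{k−1}/(k−1)!. -/
open MeasureTheory

/-- The polynomial hills `m^k`: `m^1` is the indicator of `[0,1)` and
`m^k(ξ) = ∫_{ξ-1}^{ξ} m^{k-1}(ρ) dρ` for `k ≥ 2`. (`hill 0` is junk.) -/
noncomputable def hill : ℕ → ℝ → ℝ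
  | 0 => fun _ => 0
  | 1 => fun ξ => if 0 ≤ ξ ∧ ξ < 1 then 1 else 0
  | k + 2 => fun ξ => ∫ ρ in (ξ - 1)..ξ, hill (k + 1) ρ

/-- The normalized function `λ̃_norm^k(ξ) = ∫_0^ξ B^{-ρα} m^k(ξ-ρ) dρ` (and `0` for `ξ < 0`). -/
noncomputable def lamNorm (B α : ℝ) (k : ℕ) (ξ : ℝ) : ℝ :=
  if 0 ≤ ξ then ∫ ρ in (0:ℝ)..ξ, B ^ (-(ρ * α)) * hill k (ξ - ρ) else 0

theorem hill_add_two (n : ℕ) (s : ℝ) :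
    hill (n + 2) s = ∫ ρ in (s - 1)..s, hill (n + 1) ρ := rfl

theorem hill_intervalIntegrable (n : ℕ) (a b : ℝ) :
    IntervalIntegrable (hill (n + 1)) volume a b := by
  induction n generalizing a b with
  | zero =>
    have h : hill (0 + 1) = Set.indicator (Set.Ico (0 : ℝ) 1) fun _ => (1 : ℝ) := by
      ext x
      simp [hill, Set.indicator_apply]
    rw [h]
    exact ((integrable_indicator_iff measurableSet_Ico).2
      (integrableOn_const (by simp))).intervalIntegrable
  | succ n ih =>
    have hc := intervalIntegral.continuous_primitive ih 0
    have h : hill (n + 1 + 1) = fun s =>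
        (∫ ρ in (0 : ℝ)..s, hill (n + 1) ρ) - ∫ ρ in (0 : ℝ)..(s - 1), hill (n + 1) ρ := by
      ext s
      rw [intervalIntegral.integral_interval_sub_left (ih _ _) (ih _ _)]
      rfl
    rw [h]
    exact (hc.sub (hc.comp (continuous_id.sub continuous_const))).intervalIntegrable a b

theorem hill_nonneg (k : ℕ) (s : ℝ) : 0 ≤ hill k s := by
  match k with
  | 0 => exact le_rfl
  | 1 => simp only [hill]; split_ifs <;> norm_num
  | n + 2 =>
    exact intervalIntegral.integral_nonneg (by linarith) fun x _ => hill_nonneg (n + 1) x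

theorem integral_sub_pow_div_factorial (n : ℕ) (a b c : ℝ) :
    ∫ r in a..b, (c - r) ^ n / (n.factorial : ℝ) =
      ((c - a) ^ (n + 1) - (c - b) ^ (n + 1)) / ((n + 1).factorial : ℝ) := by
  rw [intervalIntegral.integral_div, intervalIntegral.integral_comp_sub_left (fun x => x ^ n),
    integral_pow, Nat.factorial_succ]
  push_cast
  field_simp

theorem hill_lower_right (n : ℕ) (s : ℝ) (h1 : (n : ℝ) ≤ s) (h2 : s < n + 1) :
    ((n : ℝ) + 1 - s) ^ n / (n.factorial : ℝ) ≤ hill (n + 1) s := by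
  induction n generalizing s with
  | zero =>
    have : (0 : ℝ) ≤ s ∧ s < 1 := by simpa using And.intro h1 h2
    simp [hill, this]
  | succ n ih =>
    push_cast at h1 h2 ⊢
    have hi := hill_intervalIntegrable n
    have hmono : ∫ r in (s - 1)..(n + 1), ((n : ℝ) + 1 - r) ^ n / (n.factorial : ℝ) ≤
        ∫ r in (s - 1)..(n + 1), hill (n + 1) r :=
      intervalIntegral.integral_mono_on_of_le_Ioo (by linarith)
        (Continuous.intervalIntegrable (by fun_prop) _ _) (hi _ _)
        fun x hx => ih x (by linarith [hx.1]) hx.2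
    have hnn : 0 ≤ ∫ r in ((n : ℝ) + 1)..s, hill (n + 1) r :=
      intervalIntegral.integral_nonneg h1 fun x _ => hill_nonneg _ x
    rw [integral_sub_pow_div_factorial, sub_self, zero_pow n.succ_ne_zero, sub_zero] at hmono
    rw [hill_add_two, ← intervalIntegral.integral_add_adjacent_intervals (hi _ (n + 1)) (hi _ _)]
    rw [show (n : ℝ) + 1 + 1 - s = n + 1 - (s - 1) by ring]
    exact hmono.trans (le_add_of_nonneg_right hnn)

theorem self_le_hill_two (s : ℝ) (h0 : 0 ≤ s) (h1 : s ≤ 1) : s ≤ hill 2 s := by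
  have hi := hill_intervalIntegrable 0
  have hmono : ∫ _ in (0 : ℝ)..s, (1 : ℝ) ≤ ∫ r in (0 : ℝ)..s, hill (0 + 1) r :=
    intervalIntegral.integral_mono_on_of_le_Ioo h0 intervalIntegrable_const (hi _ _)
      fun x hx => by simp [hill, hx.1.le, hx.2.trans_le h1]
  have hnn : 0 ≤ ∫ r in (s - 1)..(0 : ℝ), hill (0 + 1) r :=
    intervalIntegral.integral_nonneg (by linarith) fun x _ => hill_nonneg _ x
  rw [intervalIntegral.integral_const, sub_zero, smul_eq_mul, mul_one] at hmono
  rw [hill_add_two 0,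
    ← intervalIntegral.integral_add_adjacent_intervals (hi _ 0) (hi _ _)]
  linarith

theorem add_le_hill_add_three (n : ℕ) (s c : ℝ) (h1 : (n : ℝ) + 1 ≤ s) (h2 : s ≤ n + 2)
    (hc : c ≤ ∫ r in (s - 1)..(n + 1), hill (n + 2) r) :
    c + (1 - ((n : ℝ) + 2 - s) ^ (n + 2)) / ((n + 2).factorial : ℝ) ≤ hill (n + 3) s := by
  have hi := hill_intervalIntegrable (n + 1)
  have hright : ∫ r in ((n : ℝ) + 1)..s, ((n : ℝ) + 2 - r) ^ (n + 1) / ((n + 1).factorial : ℝ) ≤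
      ∫ r in ((n : ℝ) + 1)..s, hill (n + 2) r :=
    intervalIntegral.integral_mono_on_of_le_Ioo h1
      (Continuous.intervalIntegrable (by fun_prop) _ _) (hi _ _) fun x hx => by
        have := hill_lower_right (n + 1) x (by push_cast; exact hx.1.le)
          (by push_cast; linarith [hx.2])
        convert this using 3
        push_cast
        ring
  rw [integral_sub_pow_div_factorial, show (n : ℝ) + 2 - (n + 1) = 1 by ring, one_pow] at hright
  rw [hill_add_two (n + 1),
    ← intervalIntegral.integral_add_adjacent_intervals (hi _ (n + 1)) (hi _ _)]
  exact add_le_add hc hright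

theorem inv_factorial_le_hill (n : ℕ) (s : ℝ) (h1 : (n : ℝ) + 1 ≤ s) (h2 : s ≤ n + 2) :
    1 / ((n + 2).factorial : ℝ) ≤ hill (n + 3) s := by
  have hi := hill_intervalIntegrable (n + 1)
  induction n generalizing s with
  | zero =>
    have hleft : ∫ r in (s - 1)..(((0 : ℕ) : ℝ) + 1), r ≤
        ∫ r in (s - 1)..(((0 : ℕ) : ℝ) + 1), hill 2 r :=
      intervalIntegral.integral_mono_on_of_le_Ioo (by linarith)
        (continuous_id.intervalIntegrable _ _) (hi _ _) fun x hx =>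
          self_le_hill_two x (by norm_num at h1; linarith [hx.1]) (by simpa using hx.2.le)
    rw [integral_id] at hleft
    refine le_trans ?_ (add_le_hill_add_three 0 s _ h1 h2 hleft)
    norm_num [Nat.factorial] at h1 h2 ⊢
    nlinarith
  | succ n ih =>
    have hleft : ∫ _ in (s - 1)..(((n + 1 : ℕ) : ℝ) + 1), 1 / ((n + 2).factorial : ℝ) ≤
        ∫ r in (s - 1)..(((n + 1 : ℕ) : ℝ) + 1), hill (n + 3) r :=
      intervalIntegral.integral_mono_on_of_le_Ioo (by linarith) intervalIntegrable_const
        (hi _ _) fun x hx => by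
          push_cast at h1 h2 hx
          exact ih x (by linarith [hx.1]) (by linarith [hx.2]) (hill_intervalIntegrable _)
    rw [intervalIntegral.integral_const, smul_eq_mul] at hleft
    refine le_trans ?_ (add_le_hill_add_three (n + 1) s _ h1 h2 hleft)
    push_cast at h1 h2 ⊢
    rw [show n + 1 + 2 = (n + 2) + 1 by ring, Nat.factorial_succ (n + 2)]
    obtain ⟨x, rfl⟩ : ∃ x, s = (n : ℝ) + 3 - x := ⟨n + 3 - s, by ring⟩
    have hx0 : 0 ≤ x := by linarith
    have hx1 : x ≤ 1 := by linarith
    have hpow : x ^ (n + 2 + 1) ≤ x := pow_le_of_le_one hx0 hx1 (by omega)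
    have hnx : 0 ≤ (n : ℝ) * x := by positivity
    rw [show (n : ℝ) + 1 + 1 - ((n : ℝ) + 3 - x - 1) = x by ring,
      show (n : ℝ) + 1 + 2 - ((n : ℝ) + 3 - x) = x by ring]
    have hf : (0 : ℝ) < (n + 2).factorial := by positivity
    push_cast
    rw [show x * (1 / ((n + 2).factorial : ℝ)) =
        ((n + 2 + 1) * x) / (((n : ℝ) + 2 + 1) * ((n + 2).factorial : ℝ)) by field_simp,
      ← add_div]
    gcongr
    linarith

theorem pow_div_factorial_le_hill_sub (n : ℕ) (s ρ : ℝ) (h1 : (n : ℝ) + 2 ≤ s)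
    (h2 : s < n + 3) (h3 : 0 ≤ ρ) (h4 : ρ ≤ 1) :
    ((n : ℝ) + 3 - s) ^ (n + 2) / ((n + 2).factorial : ℝ) ≤ hill (n + 3) (s - ρ) := by
  rcases le_total ((n : ℝ) + 2) (s - ρ) with h | h
  · have := hill_lower_right (n + 2) (s - ρ) (by push_cast; exact h) (by push_cast; linarith)
    push_cast at this
    refine le_trans ?_ this
    have : (0 : ℝ) ≤ n + 3 - s := by linarith
    gcongr ?_ ^ _ / _
    linarith
  · refine le_trans ?_ (inv_factorial_le_hill n (s - ρ) (by linarith) h)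
    gcongr
    exact pow_le_one₀ (by linarith) (by linarith)

theorem integral_rpow_neg_mul (B α : ℝ) (hB : 1 < B) (hα : 0 < α) :
    ∫ ρ in (0 : ℝ)..1, B ^ (-(ρ * α)) = (1 - B ^ (-α)) / (α * Real.log B) := by
  have hB0 : 0 < B := by linarith
  have hc : α * Real.log B ≠ 0 := (mul_pos hα (Real.log_pos hB)).ne'
  have hderiv : ∀ x : ℝ, HasDerivAt (fun ρ : ℝ => -(B ^ (-(ρ * α))) / (α * Real.log B))
      (B ^ (-(x * α))) x := fun x => by
    have hlin : HasDerivAt (fun ρ : ℝ => -(ρ * α)) (-α) x := by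
      simpa using ((hasDerivAt_id' x).mul_const α).fun_neg
    refine ((hlin.const_rpow hB0).fun_neg.div_const (α * Real.log B)).congr_deriv ?_
    rw [div_eq_iff hc]
    ring
  rw [intervalIntegral.integral_eq_sub_of_hasDerivAt (fun x _ => hderiv x)
    (Continuous.intervalIntegrable
      (Continuous.rpow continuous_const (by fun_prop) fun _ => Or.inl hB0.ne') _ _)]
  simp
  ring

theorem lamNorm_lower_right (B α : ℝ) (hB : 1 < B) (hα : 0 < α) (k : ℕ) (hk : 3 ≤ k)
    (ξ : ℝ) (h1 : (k : ℝ) - 1 ≤ ξ) (h2 : ξ ≤ (k : ℝ)) :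
    (1 - B ^ (-α)) ^ k / (α * Real.log B)
        * (((k : ℝ) - ξ) ^ (k - 1) / (Nat.factorial (k - 1) : ℝ)) ≤
      lamNorm B α k ξ := by
  have hB0 : 0 < B := by linarith
  obtain ⟨n, rfl⟩ : ∃ n, k = n + 3 := ⟨k - 3, by omega⟩
  have hk1 : n + 3 - 1 = n + 2 := rfl
  push_cast at h1 h2
  have hξ : 1 ≤ ξ := by linarith [(Nat.cast_nonneg n : (0 : ℝ) ≤ n)]
  have hnn : ∀ ρ : ℝ, 0 ≤ B ^ (-(ρ * α)) * hill (n + 3) (ξ - ρ) := fun ρ =>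
    mul_nonneg (Real.rpow_nonneg hB0.le _) (hill_nonneg _ _)
  have hcont : Continuous fun ρ : ℝ => B ^ (-(ρ * α)) :=
    Continuous.rpow continuous_const (by fun_prop) fun _ => Or.inl hB0.ne'
  rw [lamNorm, if_pos (by linarith), hk1]
  push_cast
  rcases h2.eq_or_lt with rfl | h2
  · rw [sub_self, zero_pow (by omega), zero_div, mul_zero]
    exact intervalIntegral.integral_nonneg (by linarith) fun ρ _ => hnn ρ
  have hint : ∀ a b, IntervalIntegrable (fun ρ => B ^ (-(ρ * α)) * hill (n + 3) (ξ - ρ))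
      volume a b := fun a b => by
    refine IntervalIntegrable.continuousOn_mul ?_ hcont.continuousOn
    simpa using (hill_intervalIntegrable (n + 2) (ξ - a) (ξ - b)).comp_sub_left ξ
  have hq0 : 0 < B ^ (-α) := Real.rpow_pos_of_pos hB0 _
  have hq1 : B ^ (-α) ≤ 1 := Real.rpow_le_one_of_one_le_of_nonpos hB.le (by linarith)
  have hc : 0 < α * Real.log B := mul_pos hα (Real.log_pos hB)
  have ht : (0 : ℝ) ≤ n + 3 - ξ := by linarith
  calc (1 - B ^ (-α)) ^ (n + 3) / (α * Real.log B)
        * (((n : ℝ) + 3 - ξ) ^ (n + 2) / ((n + 2).factorial : ℝ))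
      ≤ (1 - B ^ (-α)) / (α * Real.log B)
        * (((n : ℝ) + 3 - ξ) ^ (n + 2) / ((n + 2).factorial : ℝ)) := by
        gcongr
        exact pow_le_of_le_one (by linarith) (by linarith) (by omega)
    _ = ∫ ρ in (0 : ℝ)..1, B ^ (-(ρ * α))
        * (((n : ℝ) + 3 - ξ) ^ (n + 2) / ((n + 2).factorial : ℝ)) := by
        rw [intervalIntegral.integral_mul_const, integral_rpow_neg_mul B α hB hα]
    _ ≤ ∫ ρ in (0 : ℝ)..1, B ^ (-(ρ * α)) * hill (n + 3) (ξ - ρ) := by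
        refine intervalIntegral.integral_mono_on zero_le_one
          ((hcont.mul continuous_const).intervalIntegrable _ _) (hint _ _) fun ρ hρ => ?_
        exact mul_le_mul_of_nonneg_left
          (pow_div_factorial_le_hill_sub n ξ ρ (by linarith) h2 hρ.1 hρ.2)
          (Real.rpow_nonneg hB0.le _)
    _ ≤ ∫ ρ in (0 : ℝ)..ξ, B ^ (-(ρ * α)) * hill (n + 3) (ξ - ρ) := by
        rw [← intervalIntegral.integral_add_adjacent_intervals (hint 0 1) (hint 1 ξ)]
        exact le_add_of_nonneg_right
          (intervalIntegral.integral_nonneg hξ fun ρ _ => hnn ρ)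
end

section
/- Let B > 1, α > 0, C = B^{1+α}, and let k ≥ 1 be an integer. Set q = (ln(1+α)/α)·(1+α)^{1/ln(1+α) − 1/α}. Then for every real x > 0, q^k·η̃^k(x) ≤ κ̃^k(x) ≤ η̃^k(x). -/
open MeasureTheory

/-- The approximation `κ̃^k` of the counting function. -/
noncomputable def ktil (B C : ℝ) : ℕ → ℝ → ℝ
  | 0 => fun x => if 1 ≤ x then 1 else 0
  | k + 1 => fun x => ∫ p in B..C, ktil B C k (x / p) / Real.log p

/-- The approximation `η̃^k` with exponential density kernel, where `C = B^{1+α}`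
and `ρ(p) = (ln p / ln B - 1)/α`. -/
noncomputable def etatil (B α : ℝ) : ℕ → ℝ → ℝ
  | 0 => fun x => if 1 ≤ x then 1 else 0
  | k + 1 => fun x => ∫ p in B..(B ^ (1 + α)),
      etatil B α k (x / p) * ((1 + α) ^ (-((Real.log p / Real.log B - 1) / α)) / Real.log B)

/-- Nonnegative, measurable and bounded functions on the line. -/
def NonnegMeasurableBounded (f : ℝ → ℝ) : Prop :=
  Measurable f ∧ (∀ x, 0 ≤ f x) ∧ ∃ M, ∀ x, f x ≤ M

lemma NonnegMeasurableBounded.intervalIntegrable {f w : ℝ → ℝ} {B C : ℝ}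
    (hf : NonnegMeasurableBounded f) (hw : IntervalIntegrable w volume B C) (x : ℝ) :
    IntervalIntegrable (fun p => f (x / p) * w p) volume B C := by
  obtain ⟨hm, h0, M, hM⟩ := hf
  rw [intervalIntegrable_iff] at hw ⊢
  refine Integrable.bdd_mul (c := M) hw ?_ ?_
  · exact (hm.comp (measurable_const.div measurable_id)).aestronglyMeasurable
  · exact Filter.Eventually.of_forall fun p => by
      rw [Real.norm_of_nonneg (h0 _)]
      exact hM _

lemma NonnegMeasurableBounded.integral {f w : ℝ → ℝ} {B C : ℝ} (hBC : B ≤ C)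
    (hf : NonnegMeasurableBounded f) (hwm : Measurable w)
    (hw : IntervalIntegrable w volume B C) (hw0 : ∀ p ∈ Set.Icc B C, 0 ≤ w p) :
    NonnegMeasurableBounded fun x => ∫ p in B..C, f (x / p) * w p := by
  obtain ⟨M, hM⟩ := hf.2.2
  refine ⟨?_, fun x => ?_, M * ∫ p in B..C, w p, fun x => ?_⟩
  · simp only [intervalIntegral.integral_of_le hBC]
    have hmeas : Measurable fun z : ℝ × ℝ => f (z.1 / z.2) * w z.2 :=
      (hf.1.comp (measurable_fst.div measurable_snd)).mul (hwm.comp measurable_snd)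
    exact (hmeas.stronglyMeasurable.integral_prod_right
      (ν := volume.restrict (Set.Ioc B C))).measurable
  · exact intervalIntegral.integral_nonneg hBC fun p hp => mul_nonneg (hf.2.1 _) (hw0 p hp)
  · rw [← intervalIntegral.integral_const_mul]
    exact intervalIntegral.integral_mono_on hBC (hf.intervalIntegrable hw x) (hw.const_mul M)
      fun p hp => mul_le_mul_of_nonneg_right (hM _) (hw0 p hp)

lemma nonnegMeasurableBounded_indicator_one_le :
    NonnegMeasurableBounded fun x : ℝ => if 1 ≤ x then 1 else 0 := by
  refine ⟨Measurable.ite measurableSet_Ici measurable_const measurable_const, fun x => ?_, 1,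
    fun x => ?_⟩ <;> dsimp only <;> split_ifs <;> norm_num

lemma intervalIntegrable_inv_log {B C : ℝ} (hB : 1 < B) (hBC : B ≤ C) :
    IntervalIntegrable (fun p => (Real.log p)⁻¹) volume B C := by
  refine ContinuousOn.intervalIntegrable ?_
  rw [Set.uIcc_of_le hBC]
  refine (Real.continuousOn_log.mono ?_).inv₀ ?_
  · intro p hp
    have : 0 < p := by linarith [hp.1]
    exact this.ne'
  · intro p hp
    exact (Real.log_pos (hB.trans_le hp.1)).ne'

/-- The exponential density used for `etatil`. -/
noncomputable def etaDensity (B α p : ℝ) : ℝ :=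
  (1 + α) ^ (-((Real.log p / Real.log B - 1) / α)) / Real.log B

lemma etaDensity_eq_exp {B α : ℝ} (hα : 0 < α) (p : ℝ) :
    etaDensity B α p =
      Real.exp (Real.log (1 + α) * -((Real.log p / Real.log B - 1) / α)) / Real.log B := by
  rw [etaDensity, Real.rpow_def_of_pos (by linarith)]

lemma measurable_etaDensity {B α : ℝ} (hα : 0 < α) : Measurable (etaDensity B α) := by
  simp only [funext (etaDensity_eq_exp (B := B) hα)]
  fun_prop

lemma intervalIntegrable_etaDensity {B α C : ℝ} (hB : 1 < B) (hα : 0 < α) (hBC : B ≤ C) :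
    IntervalIntegrable (etaDensity B α) volume B C := by
  refine ContinuousOn.intervalIntegrable ?_
  rw [Set.uIcc_of_le hBC]
  simp only [funext (etaDensity_eq_exp (B := B) hα)]
  have hlog : ContinuousOn Real.log (Set.Icc B C) := Real.continuousOn_log.mono fun p hp => by
    have : 0 < p := by linarith [hp.1]
    exact this.ne'
  fun_prop

lemma inv_log_le_etaDensity {B α p : ℝ} (hB : 1 < B) (hα : 0 < α)
    (hp : p ∈ Set.Icc B (B ^ (1 + α))) : (Real.log p)⁻¹ ≤ etaDensity B α p := by
  have hB0 : 0 < B := by linarith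
  have hlB := Real.log_pos hB
  have hlp := Real.log_pos (hB.trans_le hp.1)
  have hle1 : Real.log B ≤ Real.log p := Real.log_le_log hB0 hp.1
  have hle2 : Real.log p ≤ (1 + α) * Real.log B := by
    rw [← Real.log_rpow hB0]
    exact Real.log_le_log (by linarith [hp.1]) hp.2
  set ρ := (Real.log p / Real.log B - 1) / α with hρ
  have hu : Real.log p = (1 + ρ * α) * Real.log B := by
    rw [hρ]; field_simp; ring
  have hρ0 : 0 ≤ ρ := by
    rw [hρ]
    exact div_nonneg (sub_nonneg.2 ((one_le_div hlB).2 hle1)) hα.le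
  have hρ1 : ρ ≤ 1 := by
    rw [hρ, div_le_one hα, sub_le_iff_le_add, div_le_iff₀ hlB]
    linarith
  have hbern := rpow_one_add_le_one_add_mul_self (by linarith : -1 ≤ α) hρ0 hρ1
  rw [etaDensity, ← hρ, hu, mul_inv, div_eq_mul_inv, Real.rpow_neg (by linarith)]
  gcongr

lemma mul_etaDensity_le_inv_log {B α p : ℝ} (hB : 1 < B) (hα : 0 < α) (hp : B ≤ p) :
    Real.log (1 + α) / α * (1 + α) ^ (1 / Real.log (1 + α) - 1 / α) * etaDensity B α p ≤
      (Real.log p)⁻¹ := by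
  have hlB := Real.log_pos hB
  have hlp := Real.log_pos (hB.trans_le hp)
  have hL : 0 < Real.log (1 + α) := Real.log_pos (by linarith)
  rw [etaDensity_eq_exp hα, Real.rpow_def_of_pos (by linarith)]
  set L := Real.log (1 + α)
  set v := L / α * (Real.log p / Real.log B) with hv
  have hexp : Real.exp (L * (1 / L - 1 / α)) *
      Real.exp (L * -((Real.log p / Real.log B - 1) / α)) = Real.exp (1 - v) := by
    rw [← Real.exp_add, hv]
    congr 1
    field_simp
    ring
  have hve : v * Real.exp (1 - v) ≤ 1 := by
    have h : v ≤ Real.exp (v - 1) := by linarith [Real.add_one_le_exp (v - 1)]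
    calc v * Real.exp (1 - v) ≤ Real.exp (v - 1) * Real.exp (1 - v) := by gcongr
      _ = 1 := by rw [← Real.exp_add]; simp
  have hfac : L / α * Real.exp (L * (1 / L - 1 / α)) *
      (Real.exp (L * -((Real.log p / Real.log B - 1) / α)) / Real.log B) =
      (v * Real.exp (1 - v)) / Real.log p := by
    rw [← hexp, hv]
    field_simp
  rw [hfac, inv_eq_one_div]
  gcongr

lemma integral_mul_le_integral_mul {f g v w : ℝ → ℝ} {B C a : ℝ} (hBC : B ≤ C)
    (hf : NonnegMeasurableBounded f) (hg : NonnegMeasurableBounded g)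
    (hv : IntervalIntegrable v volume B C) (hw : IntervalIntegrable w volume B C)
    (hw0 : ∀ p ∈ Set.Icc B C, 0 ≤ w p) {b : ℝ} (ha : 0 ≤ a)
    (hfg : ∀ x, a * f x ≤ g x) (hvw : ∀ p ∈ Set.Icc B C, b * v p ≤ w p) (x : ℝ) :
    a * b * ∫ p in B..C, f (x / p) * v p ≤ ∫ p in B..C, g (x / p) * w p := by
  rw [← intervalIntegral.integral_const_mul]
  refine intervalIntegral.integral_mono_on hBC ((hf.intervalIntegrable hv x).const_mul _)
    (hg.intervalIntegrable hw x) fun p hp => ?_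
  calc a * b * (f (x / p) * v p) = a * f (x / p) * (b * v p) := by ring
    _ ≤ a * f (x / p) * w p :=
        mul_le_mul_of_nonneg_left (hvw p hp) (mul_nonneg ha (hf.2.1 _))
    _ ≤ g (x / p) * w p := mul_le_mul_of_nonneg_right (hfg _) (hw0 p hp)

lemma ktil_succ (B C : ℝ) (k : ℕ) :
    ktil B C (k + 1) = fun x => ∫ p in B..C, ktil B C k (x / p) * (Real.log p)⁻¹ := by
  simp only [ktil, div_eq_mul_inv]

lemma etatil_succ (B α : ℝ) (k : ℕ) :
    etatil B α (k + 1) =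
      fun x => ∫ p in B..(B ^ (1 + α)), etatil B α k (x / p) * etaDensity B α p := rfl

lemma nonnegMeasurableBounded_ktil {B C : ℝ} (hB : 1 < B) (hBC : B ≤ C) (k : ℕ) :
    NonnegMeasurableBounded (ktil B C k) := by
  induction k with
  | zero => exact nonnegMeasurableBounded_indicator_one_le
  | succ k ih =>
    rw [ktil_succ]
    exact ih.integral hBC Real.measurable_log.inv (intervalIntegrable_inv_log hB hBC)
      fun p hp => (inv_pos.2 (Real.log_pos (hB.trans_le hp.1))).le

lemma etaDensity_nonneg {B α : ℝ} (hB : 1 < B) (hα : 0 < α) (p : ℝ) :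
    0 ≤ etaDensity B α p :=
  div_nonneg (Real.rpow_nonneg (by linarith) _) (Real.log_pos hB).le

lemma le_rpow_one_add {B α : ℝ} (hB : 1 < B) (hα : 0 < α) : B ≤ B ^ (1 + α) :=
  Real.self_le_rpow_of_one_le hB.le (by linarith)

lemma nonnegMeasurableBounded_etatil {B α : ℝ} (hB : 1 < B) (hα : 0 < α) (k : ℕ) :
    NonnegMeasurableBounded (etatil B α k) := by
  induction k with
  | zero => exact nonnegMeasurableBounded_indicator_one_le
  | succ k ih =>
    rw [etatil_succ]
    exact ih.integral (le_rpow_one_add hB hα) (measurable_etaDensity hα)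
      (intervalIntegrable_etaDensity hB hα (le_rpow_one_add hB hα))
      fun p _ => etaDensity_nonneg hB hα p

theorem ktil_vs_etatil (B α C : ℝ) (hB : 1 < B) (hα : 0 < α)
    (hC : C = B ^ (1 + α)) (k : ℕ) (hk : 1 ≤ k) (x : ℝ) (hx : 0 < x) :
    (Real.log (1 + α) / α * (1 + α) ^ (1 / Real.log (1 + α) - 1 / α)) ^ k * etatil B α k x ≤
      ktil B C k x ∧
    ktil B C k x ≤ etatil B α k x := by
  subst hC
  have hBC := le_rpow_one_add hB hα
  have hinv := intervalIntegrable_inv_log hB hBC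
  have heta := intervalIntegrable_etaDensity hB hα hBC
  have hq : 0 ≤ Real.log (1 + α) / α * (1 + α) ^ (1 / Real.log (1 + α) - 1 / α) :=
    mul_nonneg (div_nonneg (Real.log_nonneg (by linarith)) hα.le)
      (Real.rpow_nonneg (by linarith) _)
  clear hk hx
  induction k generalizing x with
  | zero => simp [ktil, etatil]
  | succ k ih =>
    have hκ := nonnegMeasurableBounded_ktil hB hBC k
    have hη := nonnegMeasurableBounded_etatil hB hα k
    rw [ktil_succ, etatil_succ, pow_succ]
    constructor
    · exact integral_mul_le_integral_mul hBC hη hκ heta hinv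
        (fun p hp => (inv_pos.2 (Real.log_pos (hB.trans_le hp.1))).le) (pow_nonneg hq k)
        (fun y => (ih y).1) (fun p hp => mul_etaDensity_le_inv_log hB hα hp.1) x
    · simpa using integral_mul_le_integral_mul hBC hκ hη hinv heta
        (fun p _ => etaDensity_nonneg hB hα p) zero_le_one
        (fun y => (one_mul _).trans_le (ih y).2)
        (fun p hp => (one_mul _).trans_le (inv_log_le_etaDensity hB hα hp)) x
end
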